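/- There is no first-order formula φ(x) in the language with one binary relation symbol E and two unary predicate symbols P and Q such that for every finite structure G in this language and every element u of G, G ⊨ φ(u) if and only if the number of elements v with E(u,v) and P(v) is greater than or equal to the number of elements v with E(u,v) and Q(v). -/

import Mathlib

open FirstOrder FirstOrder.Language

/-- Relation symbols: one binary relation `E` and two unary predicates `P`, `Q`. -/
inductive GRel : ℕ → Type
  | E : GRel 2
  | P : GRel 1
  | Q : GRel 1

/-- The first-order language with one binary relation symbol E and two unary
predicate symbols P and Q. -/
def GraphLang : FirstOrder.Language := ⟨fun _ => Empty, GRel⟩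

/-- The vertices of a star whose center has `s true` leaves labeled `P` and `s false` leaves
labeled `Q`; the center is `none`. -/
def LabeledStar (s : Bool → ℕ) : Type := Option (Σ b : Bool, Fin (s b))

namespace LabeledStar

variable {s t : Bool → ℕ}

instance : Fintype (LabeledStar s) := inferInstanceAs (Fintype (Option (Σ b : Bool, Fin (s b))))

/-- The center of the star. -/
def center : LabeledStar s := (none : Option (Σ b : Bool, Fin (s b)))

/-- The `i`-th leaf with label `b`. -/
def leaf (b : Bool) (i : Fin (s b)) : LabeledStar s := some ⟨b, i⟩

/-- The label of a vertex, which is `none` for the center. -/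
def color (x : LabeledStar s) : Option Bool := Option.map Sigma.fst x

theorem eq_center_or_leaf (x : LabeledStar s) : x = center ∨ ∃ b i, x = leaf b i := by
  rcases x with _ | ⟨b, i⟩
  · exact Or.inl rfl
  · exact Or.inr ⟨b, i, rfl⟩

@[simp] theorem color_center : (center : LabeledStar s).color = none := rfl

@[simp] theorem color_leaf (b : Bool) (i : Fin (s b)) : (leaf b i).color = some b := rfl

theorem leaf_injective (b : Bool) : Function.Injective (leaf (s := s) b) := by
  intro i j h
  have h' : (some ⟨b, i⟩ : Option (Σ b, Fin (s b))) = some ⟨b, j⟩ := h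
  simpa using h'

/-- Edges lead from the center to every leaf, and leaves are labeled by their color. -/
instance : GraphLang.Structure (LabeledStar s) where
  funMap f := f.elim
  RelMap r xs := match r with
    | GRel.E => color (xs 0) = none ∧ color (xs 1) ≠ none
    | GRel.P => color (xs 0) = some true
    | GRel.Q => color (xs 0) = some false

theorem relMap_congr {n : ℕ} (r : GraphLang.Relations n) {xs : Fin n → LabeledStar s}
    {ys : Fin n → LabeledStar t} (h : ∀ i, (xs i).color = (ys i).color) :
    Structure.RelMap r xs ↔ Structure.RelMap r ys := by
  cases r <;> simp [Structure.RelMap, h]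

theorem card_color_eq (b : Bool) : Nat.card {x : LabeledStar s // x.color = some b} = s b := by
  have : Function.Bijective
      (fun i : Fin (s b) => (⟨leaf b i, rfl⟩ : {x : LabeledStar s // x.color = some b})) := by
    refine ⟨fun i j h => leaf_injective b (congrArg Subtype.val h), ?_⟩
    rintro ⟨x, hx⟩
    obtain rfl | ⟨c, i, rfl⟩ := x.eq_center_or_leaf
    · simp at hx
    · obtain rfl : c = b := by simpa using hx
      exact ⟨i, rfl⟩
  rw [← Nat.card_eq_of_bijective _ this, Nat.card_fin]

theorem card_P_successors : Nat.card {v : LabeledStar s //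
    Structure.RelMap (L := GraphLang) (M := LabeledStar s) GRel.E ![center, v] ∧
      Structure.RelMap (L := GraphLang) (M := LabeledStar s) GRel.P ![v]} = s true := by
  refine (Nat.card_congr (Equiv.subtypeEquivRight fun v => ?_)).trans (card_color_eq true)
  simp +contextual [Structure.RelMap]

theorem card_Q_successors : Nat.card {v : LabeledStar s //
    Structure.RelMap (L := GraphLang) (M := LabeledStar s) GRel.E ![center, v] ∧
      Structure.RelMap (L := GraphLang) (M := LabeledStar s) GRel.Q ![v]} = s false := by
  refine (Nat.card_congr (Equiv.subtypeEquivRight fun v => ?_)).trans (card_color_eq false)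
  simp +contextual [Structure.RelMap]

/-- Two tuples of vertices have the same colors and the same equalities among their entries. -/
def SameType {ι : Type*} (f : ι → LabeledStar s) (g : ι → LabeledStar t) : Prop :=
  (∀ i, (f i).color = (g i).color) ∧ ∀ i j, f i = f j ↔ g i = g j

theorem SameType.symm {ι : Type*} {f : ι → LabeledStar s} {g : ι → LabeledStar t}
    (h : SameType f g) : SameType g f :=
  ⟨fun i => (h.1 i).symm, fun i j => (h.2 i j).symm⟩

/-- Entries may be added to both tuples, if they satisfy the same equations. -/
theorem SameType.snoc {α : Type*} {n : ℕ} {v : α → LabeledStar s} {w : α → LabeledStar t}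
    {xs : Fin n → LabeledStar s} {ys : Fin n → LabeledStar t}
    (h : SameType (Sum.elim v xs) (Sum.elim w ys)) {x : LabeledStar s} {y : LabeledStar t}
    (hc : x.color = y.color) (he : ∀ i, Sum.elim v xs i = x ↔ Sum.elim w ys i = y) :
    SameType (Sum.elim v (Fin.snoc xs x : Fin (n + 1) → LabeledStar s))
      (Sum.elim w (Fin.snoc ys y : Fin (n + 1) → LabeledStar t)) := by
  have he' : ∀ i, x = Sum.elim v xs i ↔ y = Sum.elim w ys i := fun i => by
    rw [eq_comm, he, eq_comm]
  simp only [SameType, Sum.forall, Fin.forall_fin_succ', Sum.elim_inl, Sum.elim_inr,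
    Fin.snoc_castSucc, Fin.snoc_last] at h he he' ⊢
  grind

/-- The forth property of the Ehrenfeucht–Fraïssé game on stars with many leaves. -/
theorem SameType.exists_snoc {n : ℕ} (ht : ∀ b, n + 1 ≤ t b) {v : Fin 1 → LabeledStar s}
    {w : Fin 1 → LabeledStar t} {xs : Fin n → LabeledStar s} {ys : Fin n → LabeledStar t}
    (h : SameType (Sum.elim v xs) (Sum.elim w ys)) (hv : v 0 = center) (hw : w 0 = center)
    (x : LabeledStar s) :
    ∃ y : LabeledStar t, SameType (Sum.elim v (Fin.snoc xs x : Fin (n + 1) → LabeledStar s))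
      (Sum.elim w (Fin.snoc ys y : Fin (n + 1) → LabeledStar t)) := by
  by_cases hx : ∃ i, Sum.elim v xs i = x
  · obtain ⟨i, rfl⟩ := hx
    exact ⟨Sum.elim w ys i, h.snoc (h.1 i) fun j => h.2 j i⟩
  · obtain rfl | ⟨b, k, rfl⟩ := x.eq_center_or_leaf
    · exact absurd ⟨Sum.inl 0, hv⟩ hx
    · obtain ⟨l, hl⟩ : ∃ l : Fin (t b), ∀ j, ys j ≠ leaf b l := by
        by_contra! hc
        choose j hj using hc
        have hinj : Function.Injective j := fun l l' e =>
          leaf_injective b (by rw [← hj l, ← hj l', e])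
        have := Fintype.card_le_of_injective j hinj
        simp only [Fintype.card_fin] at this
        have := ht b
        omega
      refine ⟨leaf b l, h.snoc rfl fun i => iff_of_false (fun e => hx ⟨i, e⟩) ?_⟩
      rcases i with i | j
      · intro e
        have := congrArg color e
        rw [Subsingleton.elim i 0] at this
        simp [hw] at this
      · exact hl j

theorem exists_term_eq_var {α : Type*} (τ : GraphLang.Term α) :
    ∃ i, τ = Term.var i := by
  cases τ with
  | var i => exact ⟨i, rfl⟩
  | func f => exact f.elim

/-- A formula cannot distinguish tuples of the same type in stars with enough leaves. -/
theorem exists_realize_iff {n : ℕ} (φ : GraphLang.BoundedFormula (Fin 1) n) :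
    ∃ N, ∀ s t : Bool → ℕ, (∀ b, N ≤ s b) → (∀ b, N ≤ t b) →
      ∀ (v : Fin 1 → LabeledStar s) (w : Fin 1 → LabeledStar t)
        (xs : Fin n → LabeledStar s) (ys : Fin n → LabeledStar t),
        v 0 = center → w 0 = center → SameType (Sum.elim v xs) (Sum.elim w ys) →
          (φ.Realize v xs ↔ φ.Realize w ys) := by
  induction φ with
  | falsum => exact ⟨0, fun _ _ _ _ _ _ _ _ _ _ _ => Iff.rfl⟩
  | equal τ₁ τ₂ =>
    obtain ⟨i, rfl⟩ := exists_term_eq_var τ₁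
    obtain ⟨j, rfl⟩ := exists_term_eq_var τ₂
    exact ⟨0, fun _ _ _ _ _ _ _ _ _ _ h => h.2 i j⟩
  | rel r τ =>
    refine ⟨0, fun _ _ _ _ _ _ _ _ _ _ h => relMap_congr r fun k => ?_⟩
    obtain ⟨i, hi⟩ := exists_term_eq_var (τ k)
    rw [hi]
    exact h.1 i
  | imp φ ψ ihφ ihψ =>
    obtain ⟨N₁, h₁⟩ := ihφ
    obtain ⟨N₂, h₂⟩ := ihψ
    refine ⟨max N₁ N₂, fun s t hs ht v w xs ys hv hw h => imp_congr ?_ ?_⟩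
    · exact h₁ s t (fun b => le_of_max_le_left (hs b)) (fun b => le_of_max_le_left (ht b))
        v w xs ys hv hw h
    · exact h₂ s t (fun b => le_of_max_le_right (hs b)) (fun b => le_of_max_le_right (ht b))
        v w xs ys hv hw h
  | @all n φ ih =>
    obtain ⟨N, hN⟩ := ih
    refine ⟨max N (n + 1), fun s t hs ht v w xs ys hv hw h => ?_⟩
    have key := fun x y => hN s t (fun b => le_of_max_le_left (hs b))
      (fun b => le_of_max_le_left (ht b)) v w (Fin.snoc xs x) (Fin.snoc ys y) hv hw
    simp only [BoundedFormula.realize_all]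
    constructor
    · intro H y
      obtain ⟨x, hx⟩ := h.symm.exists_snoc (fun b => le_of_max_le_right (hs b)) hw hv y
      exact (key x y hx.symm).1 (H x)
    · intro H x
      obtain ⟨y, hy⟩ := h.exists_snoc (fun b => le_of_max_le_right (ht b)) hv hw x
      exact (key x y hy).2 (H y)

end LabeledStar

/-- No first-order formula φ(x) over this language expresses, on
finite structures, that the number of E-successors of x satisfying P is at least
the number of E-successors of x satisfying Q. -/
theorem no_FO_formula_counts_successors :
    ¬ ∃ φ : GraphLang.Formula (Fin 1),
      ∀ (M : Type) [GraphLang.Structure M] [Fintype M] (u : M),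
        φ.Realize (fun _ => u) ↔
          Nat.card {v : M // Structure.RelMap (L := GraphLang) (M := M) GRel.E ![u, v] ∧
                             Structure.RelMap (L := GraphLang) (M := M) GRel.Q ![v]} ≤
          Nat.card {v : M // Structure.RelMap (L := GraphLang) (M := M) GRel.E ![u, v] ∧
                             Structure.RelMap (L := GraphLang) (M := M) GRel.P ![v]} := by
  rintro ⟨φ, hφ⟩
  obtain ⟨N, hN⟩ := LabeledStar.exists_realize_iff φ
  have hs := hφ (LabeledStar fun _ => N) LabeledStar.center
  have ht := hφ (LabeledStar fun b => bif b then N else N + 1) LabeledStar.center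
  rw [LabeledStar.card_P_successors, LabeledStar.card_Q_successors] at hs ht
  have := hN (fun _ => N) (fun b => bif b then N else N + 1) (fun _ => le_rfl)
    (by rintro (_ | _) <;> simp) (fun _ => LabeledStar.center) (fun _ => LabeledStar.center)
    default default rfl rfl ⟨by rintro (_ | i) <;> [rfl; exact i.elim0],
      by rintro (_ | i) (_ | j) <;> first | exact i.elim0 | exact j.elim0 | simp⟩
  have := ht.1 (this.1 (hs.2 le_rfl))
  simp at this
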